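/- Let 0 < β < 1, λ > 0, α ≥ 0, and s ≥ 0. Then the function x ↦ (e^{−sx} − 1) · α · e^{−λx} · x^{−(1+β)} is (Lebesgue) integrable on (0, ∞), and ∫_0^∞ (e^{−sx} − 1) · α · e^{−λx} · x^{−(1+β)} dx = α · Γ(−β) · ((λ + s)^β − λ^β), where Γ is the Gamma function evaluated at the negative real number −β via its standard extension. -/

import Mathlib

open MeasureTheory Set Filter Topology

lemma integrableOn_rpow_mul_exp_neg_mul {r b : ℝ} (hr : -1 < r) (hb : 0 < b) :
    IntegrableOn (fun x : ℝ => x ^ r * Real.exp (-b * x)) (Ioi 0) := by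
  simpa only [Real.rpow_one] using integrableOn_rpow_mul_exp_neg_mul_rpow hr one_pos hb

lemma abs_exp_sub_exp_le {lam s x : ℝ} (hs : 0 ≤ s) (hx : 0 ≤ x) :
    |Real.exp (-(lam + s) * x) - Real.exp (-lam * x)| ≤ s * x * Real.exp (-lam * x) := by
  have h : Real.exp (-(lam + s) * x) = Real.exp (-s * x) * Real.exp (-lam * x) := by
    rw [← Real.exp_add]; ring_nf
  have h1 : -s * x + 1 ≤ Real.exp (-s * x) := Real.add_one_le_exp _
  have h2 : Real.exp (-s * x) ≤ 1 := Real.exp_le_one_iff.2 (by nlinarith)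
  have h3 := Real.exp_pos (-lam * x)
  rw [h, abs_le]
  constructor <;> nlinarith [mul_nonneg hs hx]

lemma integrableOn_exp_sub_exp_mul_rpow {β lam s : ℝ} (hβ1 : β < 1) (hlam : 0 < lam)
    (hs : 0 ≤ s) :
    IntegrableOn (fun x : ℝ =>
      (Real.exp (-(lam + s) * x) - Real.exp (-lam * x)) * x ^ (-(1 + β))) (Ioi 0) := by
  refine ((integrableOn_rpow_mul_exp_neg_mul (r := -β) (by linarith) hlam).const_mul s).mono'
    (by fun_prop) ?_
  filter_upwards [ae_restrict_mem measurableSet_Ioi] with x hx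
  have hx : 0 < x := hx
  have hpow : x ^ (-β) = x * x ^ (-(1 + β)) := by
    rw [show -β = 1 + -(1 + β) by ring, Real.rpow_add hx, Real.rpow_one]
  rw [Real.norm_eq_abs, abs_mul, abs_of_pos (Real.rpow_pos_of_pos hx (-(1 + β))), hpow]
  calc _ ≤ s * x * Real.exp (-lam * x) * x ^ (-(1 + β)) := by
        gcongr; exact abs_exp_sub_exp_le hs hx.le
    _ = _ := by ring

lemma integral_exp_sub_exp_mul_rpow {β lam s : ℝ} (hβ0 : 0 < β) (hβ1 : β < 1)
    (hlam : 0 < lam) (hs : 0 ≤ s) :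
    ∫ x in Ioi (0 : ℝ), (Real.exp (-(lam + s) * x) - Real.exp (-lam * x)) * x ^ (-(1 + β))
      = Real.Gamma (-β) * ((lam + s) ^ β - lam ^ β) := by
  have hlams : 0 < lam + s := by linarith
  let u : ℝ → ℝ := fun x => Real.exp (-(lam + s) * x) - Real.exp (-lam * x)
  let u' : ℝ → ℝ := fun x =>
    Real.exp (-(lam + s) * x) * (-(lam + s)) - Real.exp (-lam * x) * (-lam)
  let v : ℝ → ℝ := fun x => x ^ (-β) / (-β)
  let v' : ℝ → ℝ := fun x => x ^ (-(1 + β))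
  have hu : ∀ x ∈ Ioi (0 : ℝ), HasDerivAt u (u' x) x := fun x _ =>
    (hasDerivAt_const_mul (-(lam + s))).exp.sub (hasDerivAt_const_mul (-lam)).exp
  have hv : ∀ x ∈ Ioi (0 : ℝ), HasDerivAt v (v' x) x := fun x hx => by
    have hx : 0 < x := hx
    convert! (Real.hasDerivAt_rpow_const (p := -β) (Or.inl hx.ne')).div_const (-β) using 1
    simp only [v']
    rw [mul_div_cancel_left₀ _ (neg_ne_zero.2 hβ0.ne')]
    ring_nf
  have hi1 := integrableOn_rpow_mul_exp_neg_mul (r := -β) (by linarith) hlams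
  have hi2 := integrableOn_rpow_mul_exp_neg_mul (r := -β) (by linarith) hlam
  have hu'v_eq : u' * v = fun x : ℝ =>
      (lam + s) / β * (x ^ (-β) * Real.exp (-(lam + s) * x))
        - lam / β * (x ^ (-β) * Real.exp (-lam * x)) := by
    ext x
    simp only [u', v, Pi.mul_apply]
    field_simp
    ring
  have hu'v : IntegrableOn (u' * v) (Ioi 0) := by
    rw [hu'v_eq]
    exact (hi1.const_mul _).sub (hi2.const_mul _)
  have hbound : ∀ x ∈ Ioi (0 : ℝ),
      ‖(u * v) x‖ ≤ s / β * (x ^ (1 - β) * Real.exp (-lam * x)) := fun x hx => by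
    have hx : 0 < x := hx
    have hpow : x ^ (1 - β) = x * x ^ (-β) := by
      rw [sub_eq_add_neg, Real.rpow_add hx, Real.rpow_one]
    simp only [u, v, Pi.mul_apply]
    rw [Real.norm_eq_abs, abs_mul, abs_div, abs_neg, abs_of_pos hβ0,
      abs_of_pos (Real.rpow_pos_of_pos hx (-β)), hpow]
    calc _ ≤ s * x * Real.exp (-lam * x) * (x ^ (-β) / β) := by
          gcongr; exact abs_exp_sub_exp_le hs hx.le
      _ = _ := by ring
  have h_zero : Tendsto (u * v) (𝓝[>] 0) (𝓝 0) := by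
    refine squeeze_zero_norm' (eventually_mem_nhdsWithin.mono hbound) ?_
    have hc : ContinuousAt
        (fun x : ℝ => s / β * (x ^ (1 - β) * Real.exp (-lam * x))) 0 :=
      continuousAt_const.mul
        ((Real.continuousAt_rpow_const 0 (1 - β) (Or.inr (by linarith))).mul (by fun_prop))
    have ht := hc.tendsto.mono_left (nhdsWithin_le_nhds (s := Ioi 0))
    simpa [Real.zero_rpow (sub_pos.2 hβ1).ne'] using ht
  have h_infty : Tendsto (u * v) atTop (𝓝 0) := by
    refine squeeze_zero_norm' ((eventually_gt_atTop 0).mono hbound) ?_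
    simpa using (tendsto_rpow_mul_exp_neg_mul_atTop_nhds_zero (1 - β) lam hlam).const_mul (s / β)
  have hgamma : ∀ b : ℝ, 0 < b →
      b / β * ∫ x in Ioi (0 : ℝ), x ^ (-β) * Real.exp (-b * x) = -Real.Gamma (-β) * b ^ β := by
    intro b hb
    have h := Real.integral_rpow_mul_exp_neg_mul_Ioi (a := 1 - β) (sub_pos.2 hβ1) hb
    have hΓ := Real.Gamma_add_one (neg_ne_zero.2 hβ0.ne')
    rw [show 1 - β - 1 = -β by ring, show 1 - β = -β + 1 by ring, hΓ, one_div,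
      Real.inv_rpow hb.le, Real.rpow_add hb, Real.rpow_neg hb.le, Real.rpow_one] at h
    simp only [neg_mul] at h ⊢
    rw [h]
    have := Real.rpow_pos_of_pos hb β
    field_simp
  have key := integral_Ioi_mul_deriv_eq_deriv_mul hu hv
    (integrableOn_exp_sub_exp_mul_rpow hβ1 hlam hs) hu'v h_zero h_infty
  have hint : ∫ x in Ioi (0 : ℝ), u' x * v x
      = -Real.Gamma (-β) * (lam + s) ^ β - -Real.Gamma (-β) * lam ^ β := by
    rw [← hgamma _ hlams, ← hgamma _ hlam, ← integral_const_mul, ← integral_const_mul,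
      ← integral_sub (hi1.const_mul _) (hi2.const_mul _)]
    exact congrArg (fun f : ℝ → ℝ => ∫ x in Ioi (0 : ℝ), f x) hu'v_eq
  rw [hint] at key
  refine key.trans ?_
  ring

/-- For `0 < β < 1`, `λ > 0`, `α ≥ 0` and `s ≥ 0`, the function
`x ↦ (e^{−sx} − 1) · α · e^{−λx} · x^{−(1+β)}` is integrable on `(0, ∞)` and
`∫_0^∞ (e^{−sx} − 1) α e^{−λx} x^{−(1+β)} dx = α Γ(−β) ((λ + s)^β − λ^β)`,
with `Γ` the (extended) Gamma function (Laplace exponent of the tempered stable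
subordinator). -/
theorem tempered_stable_subordinator_laplace_exponent
    (β lam α s : ℝ) (hβ0 : 0 < β) (hβ1 : β < 1) (hlam : 0 < lam) (hα : 0 ≤ α)
    (hs : 0 ≤ s) :
    IntegrableOn
      (fun x : ℝ => (Real.exp (-s * x) - 1) * α * Real.exp (-lam * x) * x ^ (-(1 + β)))
      (Ioi (0 : ℝ)) ∧
    ∫ x in Ioi (0 : ℝ),
        (Real.exp (-s * x) - 1) * α * Real.exp (-lam * x) * x ^ (-(1 + β))
      = α * Real.Gamma (-β) * ((lam + s) ^ β - lam ^ β) := by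
  have heq : (fun x : ℝ =>
      (Real.exp (-s * x) - 1) * α * Real.exp (-lam * x) * x ^ (-(1 + β))) = fun x =>
      α * ((Real.exp (-(lam + s) * x) - Real.exp (-lam * x)) * x ^ (-(1 + β))) := by
    ext x
    rw [show -(lam + s) * x = -s * x + -lam * x by ring, Real.exp_add]
    ring
  rw [heq]
  refine ⟨(integrableOn_exp_sub_exp_mul_rpow hβ1 hlam hs).const_mul α, ?_⟩
  rw [integral_const_mul, integral_exp_sub_exp_mul_rpow hβ0 hβ1 hlam hs, mul_assoc]
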